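/- Let ψ⁰ ∈ 𝒟¹ and define ψ(u, t) := (Υ^{-1} ∘ θ_t ∘ Υ(ψ⁰))(u). Then each ψ_i belongs to C¹(ℝ₊², ℝ₊), ψ(·, t) ∈ 𝒟¹ for all t ≥ 0, and ψ solves ∂_t ψ_i = − v_i^eff(∂_u ψ) ∂_u ψ_i on ℝ₊² for i = 1, …, I with ψ(·, 0) = ψ⁰. Moreover, ψ is the unique solution of this initial value problem in the class of functions ψ with each component in C¹(ℝ₊², ℝ₊) and satisfying ψ(·, t) ∈ 𝒟¹ for all t ≥ 0. -/

import Mathlib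

open Set Filter

noncomputable section

/-- `f ∈ 𝒞`: continuous, non-decreasing, `ℝ₊`-valued on `ℝ₊`, with `f 0 = 0`. -/
def memC (f : ℝ → ℝ) : Prop :=
  ContinuousOn f (Ici 0) ∧ MonotoneOn f (Ici 0) ∧ f 0 = 0 ∧ ∀ u ∈ Ici (0:ℝ), 0 ≤ f u

/-- `f ∈ 𝒞^↑`: member of `𝒞` that is strictly increasing and tends to `∞` at `∞`. -/
def memCup (f : ℝ → ℝ) : Prop :=
  memC f ∧ StrictMonoOn f (Ici 0) ∧ Tendsto f atTop atTop

/-- the soliton size associated with the index `i : Fin I`, namely `i+1`, as a real number. -/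
def sz {I : ℕ} (i : Fin I) : ℝ := (i : ℕ) + 1

/-- the effective-distance (integrated slot density) function `φ_i`. -/
def phi {I : ℕ} (ψ : Fin I → ℝ → ℝ) (i : Fin I) (u : ℝ) : ℝ :=
  u - ∑ j, 2 * min (sz i) (sz j) * ψ j u

/-- the top effective-distance function `φ_I` (note `min (I, j) = j` for `j ≤ I`). -/
def phiTop {I : ℕ} (ψ : Fin I → ℝ → ℝ) (u : ℝ) : ℝ :=
  u - ∑ j, 2 * sz j * ψ j u

/-- `ψ ∈ 𝓕`. -/
def memF {I : ℕ} (ψ : Fin I → ℝ → ℝ) : Prop :=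
  (∀ i, memC (ψ i)) ∧ memCup (phiTop ψ)

/-- the inverse of `f : ℝ₊ → ℝ₊` (as a function `ℝ → ℝ` supported in domain `Ici 0`). -/
def rinv (f : ℝ → ℝ) : ℝ → ℝ := Function.invFunOn f (Ici 0)

/-- the effective scaling (scattering) map `Υ`. -/
def Upsilon {I : ℕ} (ψ : Fin I → ℝ → ℝ) : Fin I → ℝ → ℝ :=
  fun i => ψ i ∘ rinv (phi ψ i)

/-- `gammaK ψb k = γ_{I-k}`, defined by downward recursion from `γ_I = id`:
`γ_i(z) = z + ∑_{j>i} 2(j-i) ψb_j (γ_j z)`. -/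
def gammaK {I : ℕ} (ψb : Fin I → ℝ → ℝ) : ℕ → ℝ → ℝ
  | 0 => fun z => z
  | k + 1 => fun z =>
      z + ∑ m ∈ (Finset.range (k + 1)).attach,
        2 * (((k + 1 : ℕ) : ℝ) - ((m : ℕ) : ℝ)) *
          (if h : (m : ℕ) < I then
              ψb ⟨I - 1 - (m : ℕ), by omega⟩ (gammaK ψb (m : ℕ) z)
            else 0)
  termination_by k => k
  decreasing_by have hm := Finset.mem_range.mp m.2; omega

/-- `γ_i`, for `i = 0, 1, …, I`. -/
def gam {I : ℕ} (ψb : Fin I → ℝ → ℝ) (i : ℕ) : ℝ → ℝ := gammaK ψb (I - i)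

/-- the spatial reconstruction (inverse scattering) map `Γ`. -/
def Gamma {I : ℕ} (ψb : Fin I → ℝ → ℝ) : Fin I → ℝ → ℝ :=
  fun i => ψb i ∘ gam ψb ((i : ℕ) + 1) ∘ rinv (gam ψb 0)

/-- the free-evolution shift `θ_t`. -/
def theta {I : ℕ} (t : ℝ) (ψb : Fin I → ℝ → ℝ) : Fin I → ℝ → ℝ :=
  fun i z => ψb i (max (z - sz i * t) 0)

/-- `ψ ∈ 𝒟`: member of `𝓕` satisfying the density condition
`∑_i i · sup_{u₁≠u₂} (ψ_i(u₁)-ψ_i(u₂))/(φ_i(u₁)-φ_i(u₂)) < 1/2`. -/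
def memD {I : ℕ} (ψ : Fin I → ℝ → ℝ) : Prop :=
  memF ψ ∧
  ∃ c : Fin I → ℝ,
    (∀ i, ∀ u₁ ∈ Ici (0:ℝ), ∀ u₂ ∈ Ici (0:ℝ), u₂ < u₁ →
      ψ i u₁ - ψ i u₂ ≤ c i * (phi ψ i u₁ - phi ψ i u₂)) ∧
    ∑ i, sz i * c i < 1 / 2

/-- `ψb ∈ 𝒟̄`: member of `𝒞^I` satisfying the density condition
`∑_i i · sup_{z₁≠z₂} (ψb_i(z₁)-ψb_i(z₂))/(z₁-z₂) < 1/2`. -/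
def memDbar {I : ℕ} (ψb : Fin I → ℝ → ℝ) : Prop :=
  (∀ i, memC (ψb i)) ∧
  ∃ c : Fin I → ℝ,
    (∀ i, ∀ z₁ ∈ Ici (0:ℝ), ∀ z₂ ∈ Ici (0:ℝ), z₂ < z₁ →
      ψb i z₁ - ψb i z₂ ≤ c i * (z₁ - z₂)) ∧
    ∑ i, sz i * c i < 1 / 2

/-- the extension `f^ℝ` of `f` to `ℝ`, by `0` on the negative half-line. -/
def extZ (f : ℝ → ℝ) : ℝ → ℝ := fun u => if 0 ≤ u then f u else 0

/-- the extension `f^{ℝ,↑}` of `f` to `ℝ`, by the identity on the negative half-line. -/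
def extId (f : ℝ → ℝ) : ℝ → ℝ := fun u => if 0 ≤ u then f u else u

/-- `f ∈ 𝒞^q`. -/
def memCq (q : ℕ) (f : ℝ → ℝ) : Prop := memC f ∧ ContDiff ℝ q (extZ f)

/-- `f ∈ 𝒞^{↑,q}`. -/
def memCupq (q : ℕ) (f : ℝ → ℝ) : Prop := memCup f ∧ ContDiff ℝ q (extId f)

/-- `f ∈ C^q(ℝ₊², ℝ₊)`: `ℝ₊`-valued and `q`-times continuously differentiable on the
quadrant (one-sided at the boundary). -/
def memCqTwo (q : ℕ) (f : ℝ → ℝ → ℝ) : Prop :=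
  (∀ u ∈ Ici (0:ℝ), ∀ t ∈ Ici (0:ℝ), 0 ≤ f u t) ∧
  ContDiffOn ℝ q (fun p : ℝ × ℝ => f p.1 p.2) (Ici 0 ×ˢ Ici 0)

/-- the matrix `M(ρ)`. -/
def Mmat {I : ℕ} (ρ : Fin I → ℝ) : Matrix (Fin I) (Fin I) ℝ :=
  Matrix.of fun i j =>
    if i = j then 1 - ∑ k ∈ Finset.univ.erase i, 2 * min (sz i) (sz k) * ρ k
    else 2 * min (sz i) (sz j) * ρ j

/-- the effective speeds `v^eff(ρ) = M(ρ)⁻¹ v`, where `v_i = i`. -/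
def veff {I : ℕ} (ρ : Fin I → ℝ) : Fin I → ℝ :=
  ((Mmat ρ)⁻¹).mulVec fun i => sz i

/-- `ρ ∈ 𝒟_density`. -/
def memDdensity {I : ℕ} (ρ : Fin I → ℝ → ℝ) : Prop :=
  (∀ i, (∀ u ∈ Ici (0:ℝ), 0 ≤ ρ i u) ∧ ContDiff ℝ 1 (extZ (ρ i))) ∧
  (∀ u ∈ Ici (0:ℝ), ∑ i, 2 * sz i * ρ i u < 1) ∧
  ∃ c : Fin I → ℝ,
    (∀ i, ∀ u ∈ Ici (0:ℝ),
      ρ i u ≤ c i * (1 - ∑ j, 2 * min (sz i) (sz j) * ρ j u)) ∧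
    ∑ i, sz i * c i < 1 / 2


open scoped Topology

/-- If `P ∘ H` is `C¹` near `x` and `H` is a local `C¹` diffeomorphism at `x`, then `P` is `C¹`
at `H x`. -/
lemma contDiffAt_of_comp_eventuallyEq {E G : Type*} [NormedAddCommGroup E] [NormedSpace ℝ E]
    [FiniteDimensional ℝ E] [NormedAddCommGroup G] [NormedSpace ℝ G] {H : E → E} {x : E}
    (hH : ContDiffAt ℝ 1 H x) (hinj : ∀ v, fderiv ℝ H x v = 0 → v = 0) {P Q : E → G}
    (hQ : ContDiffAt ℝ 1 Q x) (hPQ : ∀ᶠ y in 𝓝 x, P (H y) = Q y) :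
    ContDiffAt ℝ 1 P (H x) := by
  have : CompleteSpace E := FiniteDimensional.complete ℝ E
  let L : E ≃ₗ[ℝ] E := LinearEquiv.ofInjectiveEndo (fderiv ℝ H x).toLinearMap
    ((injective_iff_map_eq_zero _).2 hinj)
  let e : E ≃L[ℝ] E := L.toContinuousLinearEquiv
  have he : HasFDerivAt H (e : E →L[ℝ] E) x := by
    have h1 : (e : E →L[ℝ] E) = fderiv ℝ H x := by
      ext v; rfl
    rw [h1]
    exact (hH.differentiableAt one_ne_zero).hasFDerivAt
  have hs := hH.hasStrictFDerivAt' he one_ne_zero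
  have hg : ContDiffAt ℝ 1 (hH.localInverse he one_ne_zero) (H x) :=
    hH.to_localInverse he one_ne_zero
  have hgx : hH.localInverse he one_ne_zero (H x) = x := hH.localInverse_apply_image he one_ne_zero
  have hr : ∀ᶠ b in 𝓝 (H x), H (hH.localInverse he one_ne_zero b) = b :=
    hs.eventually_right_inverse
  have hcomp : ContDiffAt ℝ 1 (Q ∘ hH.localInverse he one_ne_zero) (H x) :=
    ContDiffAt.comp _ (by rw [hgx]; exact hQ) hg
  refine hcomp.congr_of_eventuallyEq ?_
  have ht := hg.continuousAt.tendsto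
  rw [hgx] at ht
  filter_upwards [hr, ht.eventually hPQ] with b hb1 hb2
  rw [hb1] at hb2
  exact hb2

lemma sz_pos {I : ℕ} (i : Fin I) : 0 < sz i := by
  unfold sz; positivity

lemma sz_le_sz {I : ℕ} {i j : Fin I} (h : i ≤ j) : sz i ≤ sz j := by
  unfold sz
  have : (i : ℕ) ≤ j := h
  gcongr

lemma min_sz_nonneg {I : ℕ} (i j : Fin I) : 0 ≤ 2 * min (sz i) (sz j) :=
  mul_nonneg zero_le_two (le_min (sz_pos i).le (sz_pos j).le)

lemma nonneg_of_triangular {I : ℕ} {d f : Fin I → ℝ} {s : ℝ} (hs : 0 ≤ s)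
    (hd : ∀ i, d i = s + ∑ j, 2 * (sz j - min (sz i) (sz j)) * f j)
    (hf : ∀ i, 0 ≤ d i → 0 ≤ f i) (i : Fin I) : 0 ≤ d i := by
  induction i using (wellFounded_gt (α := Fin I)).induction with
  | _ i ih =>
    rw [hd i]
    refine add_nonneg hs (Finset.sum_nonneg fun j _ => ?_)
    rcases le_or_gt j i with h | h
    · rw [min_eq_right (sz_le_sz h)]; simp
    · exact mul_nonneg (mul_nonneg zero_le_two (sub_nonneg.2 (min_le_right _ _))) (hf j (ih j h))

lemma triangular_of_eq {I : ℕ} {d f : Fin I → ℝ} {h : ℝ}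
    (hd : ∀ i, d i + ∑ j, 2 * min (sz i) (sz j) * f j = h) (i : Fin I) :
    d i = (h - ∑ j, 2 * sz j * f j) + ∑ j, 2 * (sz j - min (sz i) (sz j)) * f j := by
  rw [← hd i]
  have : ∑ j, 2 * (sz j - min (sz i) (sz j)) * f j
      = ∑ j, 2 * sz j * f j - ∑ j, 2 * min (sz i) (sz j) * f j := by
    rw [← Finset.sum_sub_distrib]
    exact Finset.sum_congr rfl fun j _ => by ring
  rw [this]; ring

/-- Sign principle for the interaction system with right-hand side `h ≥ 0`. -/
lemma nonneg_of_interaction {I : ℕ} {d f : Fin I → ℝ} {h : ℝ} (hh : 0 ≤ h)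
    (hd : ∀ i, d i + ∑ j, 2 * min (sz i) (sz j) * f j = h)
    (hpos : ∀ i, 0 ≤ d i → 0 ≤ f i) (hneg : ∀ i, d i ≤ 0 → f i ≤ 0) (i : Fin I) :
    0 ≤ d i := by
  have ht := triangular_of_eq hd
  rcases le_total 0 (h - ∑ j, 2 * sz j * f j) with hs | hs
  · exact nonneg_of_triangular hs ht hpos i
  · have h1 : ∀ i, 0 ≤ (fun i => - d i) i :=
      nonneg_of_triangular (d := fun i => - d i) (f := fun i => - f i) (neg_nonneg.2 hs)
        (fun i => by
          simp only [ht i, mul_neg, Finset.sum_neg_distrib]; ring)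
        (fun i hi => neg_nonneg.2 (hneg i (neg_nonneg.1 hi)))
    have h2 : ∀ j, f j ≤ 0 := fun j => hneg j (neg_nonneg.1 (h1 j))
    have h3 : ∑ j, 2 * min (sz i) (sz j) * f j ≤ 0 :=
      Finset.sum_nonpos fun j _ => mul_nonpos_of_nonneg_of_nonpos (min_sz_nonneg i j) (h2 j)
    linarith [hd i]

lemma pos_of_interaction {I : ℕ} {d f : Fin I → ℝ} {h : ℝ} (hh : 0 < h)
    (hd : ∀ i, d i + ∑ j, 2 * min (sz i) (sz j) * f j = h)
    (hpos : ∀ i, 0 ≤ d i → 0 ≤ f i) (hneg : ∀ i, d i ≤ 0 → f i ≤ 0) (i : Fin I) :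
    0 < d i := by
  have ht := triangular_of_eq hd
  have hf : ∀ j, 0 ≤ f j := fun j => hpos j (nonneg_of_interaction hh.le hd hpos hneg j)
  have hnn : 0 ≤ ∑ j, 2 * (sz j - min (sz i) (sz j)) * f j :=
    Finset.sum_nonneg fun j _ =>
      mul_nonneg (mul_nonneg zero_le_two (sub_nonneg.2 (min_le_right _ _))) (hf j)
  rcases lt_or_ge 0 (h - ∑ j, 2 * sz j * f j) with hs | hs
  · rw [ht i]; linarith
  · have h1 : ∀ i, 0 ≤ (fun i => - d i) i :=
      nonneg_of_triangular (d := fun i => - d i) (f := fun i => - f i) (neg_nonneg.2 hs)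
        (fun i => by
          simp only [ht i, mul_neg, Finset.sum_neg_distrib]; ring)
        (fun i hi => neg_nonneg.2 (hneg i (neg_nonneg.1 hi)))
    have h2 : ∀ j, f j ≤ 0 := fun j => hneg j (neg_nonneg.1 (h1 j))
    have h3 : ∑ j, 2 * sz j * f j ≤ 0 :=
      Finset.sum_nonpos fun j _ =>
        mul_nonpos_of_nonneg_of_nonpos (mul_nonneg zero_le_two (sz_pos j).le) (h2 j)
    linarith

lemma eq_zero_of_interaction {I : ℕ} {d f : Fin I → ℝ}
    (hd : ∀ i, d i + ∑ j, 2 * min (sz i) (sz j) * f j = 0)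
    (hpos : ∀ i, 0 ≤ d i → 0 ≤ f i) (hneg : ∀ i, d i ≤ 0 → f i ≤ 0) (i : Fin I) :
    d i = 0 := by
  refine le_antisymm ?_ (nonneg_of_interaction le_rfl hd hpos hneg i)
  have := nonneg_of_interaction (d := fun i => - d i) (f := fun i => - f i) le_rfl
    (fun i => by
      have := hd i
      simp only [mul_neg, Finset.sum_neg_distrib]; linarith)
    (fun i hi => neg_nonneg.2 (hneg i (neg_nonneg.1 hi)))
    (fun i hi => neg_nonpos.2 (hpos i (neg_nonpos.1 hi))) i
  linarith

lemma Mmat_mulVec {I : ℕ} (ρ w : Fin I → ℝ) (i : Fin I) :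
    (Mmat ρ).mulVec w i = (1 - ∑ k, 2 * min (sz i) (sz k) * ρ k) * w i
      + ∑ j, 2 * min (sz i) (sz j) * (ρ j * w j) := by
  have h1 := Finset.add_sum_erase Finset.univ (fun k => 2 * min (sz i) (sz k) * ρ k)
    (Finset.mem_univ i)
  have h2 := Finset.add_sum_erase Finset.univ (fun k => 2 * min (sz i) (sz k) * (ρ k * w k))
    (Finset.mem_univ i)
  have h3 := Finset.add_sum_erase Finset.univ (fun k => Mmat ρ i k * w k) (Finset.mem_univ i)
  have h4 : ∑ k ∈ Finset.univ.erase i, Mmat ρ i k * w k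
      = ∑ k ∈ Finset.univ.erase i, 2 * min (sz i) (sz k) * (ρ k * w k) :=
    Finset.sum_congr rfl fun k hk => by
      have : i ≠ k := (Finset.ne_of_mem_erase hk).symm
      simp only [Mmat, Matrix.of_apply, if_neg this]; ring
  have h5 : Mmat ρ i i = 1 - ∑ k ∈ Finset.univ.erase i, 2 * min (sz i) (sz k) * ρ k := by
    simp [Mmat]
  simp only [Matrix.mulVec, dotProduct]
  rw [← h3, h4, h5, ← h1, ← h2]
  ring

lemma isUnit_Mmat_det {I : ℕ} {ρ : Fin I → ℝ} (hρ : ∀ i, 0 ≤ ρ i)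
    (hq : ∀ i : Fin I, 0 < 1 - ∑ k, 2 * min (sz i) (sz k) * ρ k) : IsUnit (Mmat ρ).det := by
  rw [← Matrix.isUnit_iff_isUnit_det, ← Matrix.mulVec_injective_iff_isUnit]
  refine (injective_iff_map_eq_zero (Mmat ρ).mulVecLin).2 fun w hw => ?_
  have h0 : ∀ i, (1 - ∑ k, 2 * min (sz i) (sz k) * ρ k) * w i = 0 := by
    refine eq_zero_of_interaction (f := fun j => ρ j * w j) (fun i => ?_) (fun i hi => ?_)
      (fun i hi => ?_)
    · rw [← Mmat_mulVec]
      exact congrFun hw i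
    · exact mul_nonneg (hρ i) (nonneg_of_mul_nonneg_right hi (hq i))
    · exact mul_nonpos_of_nonneg_of_nonpos (hρ i) (by
        by_contra! hc
        exact absurd hi (not_le.2 (mul_pos (hq i) hc)))
  funext i
  exact (mul_eq_zero.1 (h0 i)).resolve_left (hq i).ne'

/-- The defining linear system of the effective speeds. -/
lemma veff_eq {I : ℕ} {ρ : Fin I → ℝ} (hρ : ∀ i, 0 ≤ ρ i)
    (hq : ∀ i : Fin I, 0 < 1 - ∑ k, 2 * min (sz i) (sz k) * ρ k) (i : Fin I) :
    (1 - ∑ k, 2 * min (sz i) (sz k) * ρ k) * veff ρ i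
      + ∑ j, 2 * min (sz i) (sz j) * (ρ j * veff ρ j) = sz i := by
  rw [← Mmat_mulVec, veff, Matrix.mulVec_mulVec, Matrix.mul_nonsing_inv _ (isUnit_Mmat_det hρ hq),
    Matrix.one_mulVec]

lemma eq_veff {I : ℕ} {ρ w : Fin I → ℝ} (hρ : ∀ i, 0 ≤ ρ i)
    (hq : ∀ i : Fin I, 0 < 1 - ∑ k, 2 * min (sz i) (sz k) * ρ k)
    (hw : ∀ i, (1 - ∑ k, 2 * min (sz i) (sz k) * ρ k) * w i
      + ∑ j, 2 * min (sz i) (sz j) * (ρ j * w j) = sz i) : veff ρ = w := by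
  have : (Mmat ρ).mulVec w = fun i => sz i := funext fun i => by rw [Mmat_mulVec, hw i]
  rw [veff, ← this, Matrix.mulVec_mulVec, Matrix.nonsing_inv_mul _ (isUnit_Mmat_det hρ hq),
    Matrix.one_mulVec]

lemma phi_sub_phi {I : ℕ} (ψ : Fin I → ℝ → ℝ) (i : Fin I) (u v : ℝ) :
    phi ψ i u - phi ψ i v = (u - v) - ∑ j, 2 * min (sz i) (sz j) * (ψ j u - ψ j v) := by
  simp only [phi, mul_sub, Finset.sum_sub_distrib]; ring

lemma phiTop_sub_phiTop {I : ℕ} (ψ : Fin I → ℝ → ℝ) (u v : ℝ) :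
    phiTop ψ u - phiTop ψ v = (u - v) - ∑ j, 2 * sz j * (ψ j u - ψ j v) := by
  simp only [phiTop, mul_sub, Finset.sum_sub_distrib]; ring

lemma phiTop_sub_le_phi_sub {I : ℕ} {ψ : Fin I → ℝ → ℝ} (hψ : ∀ i, MonotoneOn (ψ i) (Ici 0))
    (i : Fin I) {u v : ℝ} (hv : 0 ≤ v) (hvu : v ≤ u) :
    phiTop ψ u - phiTop ψ v ≤ phi ψ i u - phi ψ i v := by
  rw [phi_sub_phi, phiTop_sub_phiTop]
  refine sub_le_sub_left (Finset.sum_le_sum fun j _ => ?_) _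
  have h1 : 0 ≤ ψ j u - ψ j v := sub_nonneg.2 (hψ j hv (hv.trans hvu) hvu)
  have h2 : min (sz i) (sz j) ≤ sz j := min_le_right _ _
  gcongr

lemma phi_sub_le {I : ℕ} {ψ : Fin I → ℝ → ℝ} (hψ : ∀ i, MonotoneOn (ψ i) (Ici 0))
    (i : Fin I) {u v : ℝ} (hv : 0 ≤ v) (hvu : v ≤ u) :
    phi ψ i u - phi ψ i v ≤ u - v := by
  rw [phi_sub_phi]
  refine sub_le_self _ (Finset.sum_nonneg fun j _ => ?_)
  exact mul_nonneg (min_sz_nonneg i j) (sub_nonneg.2 (hψ j hv (hv.trans hvu) hvu))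

/-- Members of `𝒟` have effective distances with increments bounded below. -/
lemma memD.exists_bounds {I : ℕ} {ψ : Fin I → ℝ → ℝ} (h : memD ψ) :
    ∃ (c : Fin I → ℝ) (δ : ℝ), (∀ i, 0 ≤ c i) ∧ ∑ i, sz i * c i < 1 / 2 ∧ 0 < δ ∧ δ ≤ 1 ∧
      (∀ i u v, 0 ≤ v → v ≤ u → ψ i u - ψ i v ≤ c i * (phi ψ i u - phi ψ i v)) ∧
      (∀ i u v, 0 ≤ v → v ≤ u → δ * (u - v) ≤ phi ψ i u - phi ψ i v) := by
  obtain ⟨⟨hC, hup⟩, c, hc, hsum⟩ := h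
  have hm : ∀ i, MonotoneOn (ψ i) (Ici 0) := fun i => (hC i).2.1
  have hc0 : ∀ i, 0 ≤ c i := fun i => by
    have h1 := hc i 1 (mem_Ici.2 zero_le_one) 0 self_mem_Ici zero_lt_one
    have h2 : 0 ≤ ψ i 1 - ψ i 0 := sub_nonneg.2 (hm i self_mem_Ici (mem_Ici.2 zero_le_one) zero_le_one)
    have h3 : 0 < phi ψ i 1 - phi ψ i 0 :=
      (sub_pos.2 (hup.2.1 self_mem_Ici (zero_le_one (α := ℝ)) zero_lt_one)).trans_le
        (phiTop_sub_le_phi_sub hm i le_rfl zero_le_one)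
    by_contra! hneg
    linarith [mul_neg_of_neg_of_pos hneg h3]
  have hc' : ∀ i u v, 0 ≤ v → v ≤ u → ψ i u - ψ i v ≤ c i * (phi ψ i u - phi ψ i v) := by
    intro i u v hv hvu
    rcases hvu.eq_or_lt with rfl | hlt
    · simp
    · exact hc i u (hv.trans hvu) v hv hlt
  refine ⟨c, 1 - 2 * ∑ i, sz i * c i, hc0, hsum, by linarith, ?_, hc', fun i u v hv hvu => ?_⟩
  · have : 0 ≤ ∑ i, sz i * c i := Finset.sum_nonneg fun i _ => mul_nonneg (sz_pos i).le (hc0 i)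
    linarith
  · refine le_trans ?_ (phiTop_sub_le_phi_sub hm i hv hvu)
    rw [phiTop_sub_phiTop]
    have : ∑ j, 2 * sz j * (ψ j u - ψ j v) ≤ ∑ j, 2 * (sz j * c j) * (u - v) :=
      Finset.sum_le_sum fun j _ => by
        have h1 : ψ j u - ψ j v ≤ c j * (u - v) := (hc' j u v hv hvu).trans
          (mul_le_mul_of_nonneg_left (phi_sub_le hm j hv hvu) (hc0 j))
        have := mul_le_mul_of_nonneg_left h1 (mul_nonneg zero_le_two (sz_pos j).le)
        linarith
    rw [← Finset.sum_mul, ← Finset.mul_sum] at this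
    linarith

lemma phi_zero {I : ℕ} {ψ : Fin I → ℝ → ℝ} (hψ : ∀ i, ψ i 0 = 0) (i : Fin I) :
    phi ψ i 0 = 0 := by
  simp [phi, hψ]

lemma memD.strictMonoOn_phi {I : ℕ} {ψ : Fin I → ℝ → ℝ} (h : memD ψ) (i : Fin I) :
    StrictMonoOn (phi ψ i) (Ici 0) := by
  obtain ⟨c, δ, -, -, hδ, -, -, hb⟩ := h.exists_bounds
  intro v hv u _ hvu
  have := hb i u v hv hvu.le
  nlinarith [mul_pos hδ (sub_pos.2 hvu)]

lemma memD.continuousOn_phi {I : ℕ} {ψ : Fin I → ℝ → ℝ} (h : memD ψ) (i : Fin I) :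
    ContinuousOn (phi ψ i) (Ici 0) :=
  continuousOn_id.sub (continuousOn_finsetSum _ fun j _ => (h.1.1 j).1.const_mul _)

lemma memD.phi_nonneg {I : ℕ} {ψ : Fin I → ℝ → ℝ} (h : memD ψ) (i : Fin I) {u : ℝ}
    (hu : 0 ≤ u) : 0 ≤ phi ψ i u := by
  rw [← phi_zero (fun j => (h.1.1 j).2.2.1) i]
  exact (h.strictMonoOn_phi i).monotoneOn self_mem_Ici hu hu

lemma memD.exists_phi_eq {I : ℕ} {ψ : Fin I → ℝ → ℝ} (h : memD ψ) (i : Fin I) {z : ℝ}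
    (hz : 0 ≤ z) : ∃ u, 0 ≤ u ∧ phi ψ i u = z := by
  have h00 := phi_zero (fun j => (h.1.1 j).2.2.1) i
  obtain ⟨c, δ, -, -, hδ, -, -, hb⟩ := h.exists_bounds
  have h0 : 0 ≤ z / δ := div_nonneg hz hδ.le
  have h1 := hb i (z / δ) 0 le_rfl h0
  rw [h00, sub_zero, sub_zero, mul_div_cancel₀ _ hδ.ne'] at h1
  obtain ⟨u, hu, rfl⟩ := intermediate_value_Icc h0
    ((h.continuousOn_phi i).mono Icc_subset_Ici_self) ⟨h00.trans_le hz, h1⟩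
  exact ⟨u, hu.1, rfl⟩

lemma memD.deriv_bounds {I : ℕ} {ψ : Fin I → ℝ → ℝ} (h : memD ψ) {u : ℝ} (hu : 0 ≤ u)
    {ρ : Fin I → ℝ} (hρ : ∀ i, HasDerivWithinAt (ψ i) (ρ i) (Ici 0) u) :
    (∀ i, 0 ≤ ρ i) ∧ ∀ i : Fin I, 0 < 1 - ∑ k, 2 * min (sz i) (sz k) * ρ k := by
  have hud : UniqueDiffWithinAt ℝ (Ici (0:ℝ)) u := uniqueDiffOn_Ici 0 u hu
  constructor
  · intro i
    rw [← (hρ i).derivWithin hud]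
    exact (h.1.1 i).2.1.derivWithin_nonneg
  · intro i
    obtain ⟨c, δ, -, -, hδ, -, -, hb⟩ := h.exists_bounds
    have h1 : HasDerivWithinAt (fun u => phi ψ i u - δ * u)
        (1 - ∑ k, 2 * min (sz i) (sz k) * ρ k - δ * 1) (Ici 0) u :=
      ((hasDerivWithinAt_id u _).sub
        (HasDerivWithinAt.fun_sum fun k _ => (hρ k).const_mul _)).sub
        ((hasDerivWithinAt_id u _).const_mul δ)
    have h2 : MonotoneOn (fun u => phi ψ i u - δ * u) (Ici 0) := fun v hv w _ hvw => by
      have := hb i w v hv hvw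
      simp only
      linarith
    have h3 := h2.derivWithin_nonneg (x := u)
    rw [h1.derivWithin hud] at h3
    linarith

/-- The profile `Υ(ψ)_i`, extended by `0` to the negative half-line. -/
def profile {I : ℕ} (ψ : Fin I → ℝ → ℝ) (i : Fin I) (z : ℝ) : ℝ := Upsilon ψ i (max z 0)

lemma memD.Upsilon_phi {I : ℕ} {ψ : Fin I → ℝ → ℝ} (h : memD ψ) (i : Fin I) {u : ℝ}
    (hu : 0 ≤ u) : Upsilon ψ i (phi ψ i u) = ψ i u := by
  have h1 : rinv (phi ψ i) (phi ψ i u) = u :=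
    (h.strictMonoOn_phi i).injOn.leftInvOn_invFunOn hu
  simp [Upsilon, h1]

lemma memD.profile_phi {I : ℕ} {ψ : Fin I → ℝ → ℝ} (h : memD ψ) (i : Fin I) {u : ℝ}
    (hu : 0 ≤ u) : profile ψ i (phi ψ i u) = ψ i u := by
  rw [profile, max_eq_left (h.phi_nonneg i hu), h.Upsilon_phi i hu]

lemma memD.profile_of_nonpos {I : ℕ} {ψ : Fin I → ℝ → ℝ} (h : memD ψ) (i : Fin I) {z : ℝ}
    (hz : z ≤ 0) : profile ψ i z = 0 := by
  have h0 := fun j => (h.1.1 j).2.2.1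
  have h1 := h.Upsilon_phi i le_rfl
  rw [phi_zero h0 i, h0] at h1
  rw [profile, max_eq_right hz, h1]

lemma memD.profile_bounds {I : ℕ} {ψ : Fin I → ℝ → ℝ} (h : memD ψ) :
    ∃ (c : Fin I → ℝ), (∀ i, 0 ≤ c i) ∧ ∑ i, sz i * c i < 1 / 2 ∧
      ∀ i z w, w ≤ z → profile ψ i z - profile ψ i w ≤ c i * (z - w) := by
  obtain ⟨c, δ, hc0, hsum, hδ, -, hc, hb⟩ := h.exists_bounds
  refine ⟨c, hc0, hsum, fun i z w hwz => ?_⟩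
  obtain ⟨u, hu, hzu⟩ := h.exists_phi_eq i (le_max_right z 0)
  obtain ⟨v, hv, hwv⟩ := h.exists_phi_eq i (le_max_right w 0)
  have h1 : max w 0 ≤ max z 0 := max_le_max_right 0 hwz
  have hvu : v ≤ u := by
    rw [← hzu, ← hwv] at h1
    exact ((h.strictMonoOn_phi i).le_iff_le hv hu).1 h1
  rw [profile, profile, ← hzu, ← hwv, h.Upsilon_phi i hu, h.Upsilon_phi i hv]
  refine (hc i u v hv hvu).trans (mul_le_mul_of_nonneg_left ?_ (hc0 i))
  rw [hzu, hwv]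
  rcases le_total w 0 with hw | hw <;> rcases le_total z 0 with hz | hz <;>
    simp only [max_eq_left, max_eq_right, hw, hz] <;> linarith

lemma memD.monotone_profile {I : ℕ} {ψ : Fin I → ℝ → ℝ} (h : memD ψ) (i : Fin I) :
    Monotone (profile ψ i) := by
  intro w z hwz
  obtain ⟨u, hu, hzu⟩ := h.exists_phi_eq i (le_max_right z 0)
  obtain ⟨v, hv, hwv⟩ := h.exists_phi_eq i (le_max_right w 0)
  have h1 : max w 0 ≤ max z 0 := max_le_max_right 0 hwz
  rw [← hzu, ← hwv] at h1
  rw [profile, profile, ← hzu, ← hwv, h.Upsilon_phi i hu, h.Upsilon_phi i hv]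
  exact (h.1.1 i).2.1 hv hu (((h.strictMonoOn_phi i).le_iff_le hv hu).1 h1)

lemma extZ_eq {f : ℝ → ℝ} (h0 : f 0 = 0) (u : ℝ) : extZ f u = f (max u 0) := by
  rcases le_or_gt 0 u with h | h
  · simp [extZ, h]
  · simp [extZ, h.le, not_le.2 h, h0]

lemma memD.contDiff_profile {I : ℕ} {ψ : Fin I → ℝ → ℝ} (h : memD ψ)
    (hψ : ∀ i, ContDiff ℝ 1 (extZ (ψ i))) (i : Fin I) : ContDiff ℝ 1 (profile ψ i) := by
  have h0 := fun j => (h.1.1 j).2.2.1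
  let Φ : ℝ → ℝ := fun u => u - ∑ j, 2 * min (sz i) (sz j) * extZ (ψ j) u
  have hΦ : ContDiff ℝ 1 Φ :=
    contDiff_id.sub (ContDiff.sum fun j _ => contDiff_const.mul (hψ j))
  have hΦpos : ∀ u, 0 ≤ u → Φ u = phi ψ i u := fun u hu => by
    simp [Φ, phi, extZ, hu]
  have hΦneg : ∀ u, u ≤ 0 → Φ u = u := fun u hu => by
    simp [Φ, extZ_eq (h0 _), hu, h0]
  have hcomp : ∀ u, profile ψ i (Φ u) = extZ (ψ i) u := fun u => by
    rcases le_or_gt 0 u with hu | hu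
    · rw [hΦpos u hu, h.profile_phi i hu]; simp [extZ, hu]
    · rw [hΦneg u hu.le, h.profile_of_nonpos i hu.le]; simp [extZ, not_le.2 hu]
  have hderiv : ∀ u, deriv Φ u ≠ 0 := fun u => by
    rcases le_or_gt 0 u with hu | hu
    · have hd : ∀ j, HasDerivAt (extZ (ψ j)) (deriv (extZ (ψ j)) u) u := fun j =>
        ((hψ j).differentiable one_ne_zero u).hasDerivAt
      have := (h.deriv_bounds hu fun j => (hd j).hasDerivWithinAt.congr
        (fun v hv => by simp [extZ, mem_Ici.1 hv]) (by simp [extZ, hu])).2 i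
      have h2 : HasDerivAt Φ _ u := (hasDerivAt_id u).sub
        (HasDerivAt.fun_sum fun k _ => (hd k).const_mul (2 * min (sz i) (sz k)))
      rw [h2.deriv]
      exact this.ne'
    · have : Φ =ᶠ[𝓝 u] id := by
        filter_upwards [Iio_mem_nhds hu] with v hv using hΦneg v (le_of_lt hv)
      rw [this.deriv_eq]
      simp
  rw [contDiff_iff_contDiffAt]
  intro z
  obtain ⟨u, rfl⟩ : ∃ u, Φ u = z := by
    rcases le_total z 0 with hz | hz
    · exact ⟨z, hΦneg z hz⟩
    · obtain ⟨u, hu, huz⟩ := h.exists_phi_eq i hz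
      exact ⟨u, (hΦpos u hu).trans huz⟩
  refine contDiffAt_of_comp_eventuallyEq hΦ.contDiffAt (fun v hv => ?_) (hψ i).contDiffAt
    (Eventually.of_forall hcomp)
  rw [fderiv_eq_smul_deriv, smul_eq_mul] at hv
  exact (mul_eq_zero.1 hv).resolve_right (hderiv u)

lemma gammaK_succ {I : ℕ} (B : Fin I → ℝ → ℝ) (k : ℕ) (z : ℝ) :
    gammaK B (k + 1) z = z + ∑ m ∈ Finset.range (k + 1), 2 * (((k + 1 : ℕ) : ℝ) - (m : ℝ)) *
      (if h : m < I then B ⟨I - 1 - m, by omega⟩ (gammaK B m z) else 0) := by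
  rw [gammaK]
  simp only
  rw [Finset.sum_attach (Finset.range (k + 1)) fun m => 2 * (((k + 1 : ℕ) : ℝ) - (m : ℝ)) *
      (if h : m < I then B ⟨I - 1 - m, by omega⟩ (gammaK B m z) else 0)]

lemma gam_eq {I : ℕ} (B : Fin I → ℝ → ℝ) {i : ℕ} (hi : i ≤ I) (z : ℝ) :
    gam B i z = z + ∑ j : Fin I, 2 * max (sz j - i) 0 * B j (gam B ((j : ℕ) + 1) z) := by
  rw [← Equiv.sum_comp Fin.revPerm]
  have hsz : ∀ j : Fin I, sz (Fin.revPerm j) = (I : ℝ) - (j : ℕ) := fun j => by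
    have hj := j.2
    have : ((j.rev : Fin I) : ℕ) + 1 + j = I := by rw [Fin.val_rev]; omega
    simp only [sz, Fin.revPerm_apply]
    have hR : ((j.rev : ℕ) : ℝ) + 1 + (j : ℕ) = I := by exact_mod_cast this
    linarith
  have hterm : ∀ j : Fin I,
      2 * max (sz (Fin.revPerm j) - i) 0 *
        B (Fin.revPerm j) (gam B ((Fin.revPerm j : Fin I) + 1) z)
      = (fun m : ℕ => 2 * max ((I : ℝ) - m - i) 0 *
        (if h : m < I then B ⟨I - 1 - m, by omega⟩ (gammaK B m z) else 0)) j := fun j => by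
    have h1 : Fin.revPerm j = (⟨I - 1 - j, by omega⟩ : Fin I) := by
      ext; simp only [Fin.revPerm_apply, Fin.val_rev]; omega
    have h2 : I - (I - 1 - (j : ℕ) + 1) = j := by omega
    simp only [hsz, j.2, dif_pos]
    rw [h1, gam]
    simp only [h2]
  rw [Finset.sum_congr rfl fun j _ => hterm j,
    Fin.sum_univ_eq_sum_range (fun m : ℕ => 2 * max ((I : ℝ) - m - i) 0 *
        (if h : m < I then B ⟨I - 1 - m, by omega⟩ (gammaK B m z) else 0)) I, gam]
  have hsub : Finset.range (I - i) ⊆ Finset.range I := Finset.range_mono (Nat.sub_le _ _)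
  rw [← Finset.sum_subset hsub]
  · rcases Nat.eq_zero_or_eq_succ_pred (I - i) with h | h
    · rw [h]; simp [gammaK]
    · rw [h, gammaK_succ]
      congr 1
      refine Finset.sum_congr rfl fun m hm => ?_
      have hm' : m ≤ (I - i).pred := Nat.lt_succ_iff.1 (Finset.mem_range.1 hm)
      have hI : I = (I - i).pred + 1 + i := by omega
      have hI' : (I : ℝ) = ((I - i).pred : ℝ) + 1 + i := by exact_mod_cast hI
      have hmR : (m : ℝ) ≤ ((I - i).pred : ℝ) := by exact_mod_cast hm'
      rw [max_eq_left (by linarith)]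
      congr 2
      push_cast
      linarith
  · intro m _ hm
    have : I ≤ m + i := by
      have := Finset.mem_range.not.1 hm
      omega
    have hR : (I : ℝ) ≤ m + i := by exact_mod_cast this
    rw [max_eq_right (by linarith)]
    simp

lemma continuous_gammaK {I : ℕ} {B : Fin I → ℝ → ℝ} (hB : ∀ i, Continuous (B i)) (k : ℕ) :
    Continuous (gammaK B k) := by
  induction k using Nat.strong_induction_on with
  | _ k ih =>
    cases k with
    | zero => exact (show gammaK B 0 = id by funext z; simp [gammaK]) ▸ continuous_id
    | succ k =>
      rw [funext (gammaK_succ B k)]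
      refine continuous_id.add (continuous_finsetSum _ fun m hm => continuous_const.mul ?_)
      by_cases h : m < I
      · simp only [dif_pos h]
        exact (hB _).comp (ih m (Finset.mem_range.1 hm))
      · simpa only [dif_neg h] using continuous_const

lemma gammaK_zero_right {I : ℕ} {B : Fin I → ℝ → ℝ} (hB : ∀ i, B i 0 = 0) (k : ℕ) :
    gammaK B k 0 = 0 := by
  induction k using Nat.strong_induction_on with
  | _ k ih =>
    cases k with
    | zero => simp [gammaK]
    | succ k =>
      rw [gammaK_succ, zero_add]
      refine Finset.sum_eq_zero fun m hm => ?_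
      rw [ih m (Finset.mem_range.1 hm)]
      simp [hB]

/-- `Γ(B)` solves the implicit system `x_i = B_i (u - ∑ 2 (i ∧ j) x_j)`. -/
lemma Gamma_eq {I : ℕ} {B : Fin I → ℝ → ℝ} (hc : ∀ i, Continuous (B i))
    (hnn : ∀ i z, 0 ≤ B i z) (h0 : ∀ i, B i 0 = 0) {u : ℝ} (hu : 0 ≤ u) (i : Fin I) :
    Gamma B i u = B i (u - ∑ j, 2 * min (sz i) (sz j) * Gamma B j u) := by
  have hsurj : u ∈ gam B 0 '' Ici 0 := by
    have h1 : gam B 0 0 = 0 := gammaK_zero_right h0 _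
    have h2 : u ≤ gam B 0 u := by
      rw [gam_eq B (Nat.zero_le I)]
      exact le_add_of_nonneg_right (Finset.sum_nonneg fun j _ =>
        mul_nonneg (mul_nonneg zero_le_two (le_max_right _ _)) (hnn _ _))
    obtain ⟨z, hz, hzu⟩ := intermediate_value_Icc hu (continuous_gammaK hc (I - 0)).continuousOn
      ⟨h1.trans_le hu, h2⟩
    exact ⟨z, hz.1, hzu⟩
  have hz : gam B 0 (rinv (gam B 0) u) = u := Function.invFunOn_eq hsurj
  have hG : ∀ j, B j (gam B ((j : ℕ) + 1) (rinv (gam B 0) u)) = Gamma B j u := fun j => rfl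
  set z := rinv (gam B 0) u
  have h1 := gam_eq B (Nat.zero_le I) z
  have h2 := gam_eq B (Nat.succ_le_of_lt i.2) z
  simp only [hG] at h1 h2
  rw [hz] at h1
  rw [← hG i]
  congr 1
  rw [← Nat.succ_eq_add_one, h2]
  nth_rw 2 [h1]
  rw [add_sub_assoc, ← Finset.sum_sub_distrib]
  congr 1
  refine Finset.sum_congr rfl fun j _ => ?_
  rw [← sub_mul, ← mul_sub]
  congr 2
  have hi : ((Nat.succ i : ℕ) : ℝ) = sz i := by simp [sz]
  rw [hi, Nat.cast_zero, sub_zero, max_eq_left (sz_pos j).le]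
  rcases le_total (sz i) (sz j) with h | h
  · rw [max_eq_left (sub_nonneg.2 h), min_eq_left h]
  · rw [max_eq_right (sub_nonpos.2 h), min_eq_right h, sub_self]

/-- The map sending shifted effective distances to the free positions `u - i t`. -/
def freePos {I : ℕ} (F : Fin I → ℝ → ℝ) (y : Fin I → ℝ) (i : Fin I) : ℝ :=
  y i + ∑ j, 2 * min (sz i) (sz j) * F j (y j)

lemma freePos_injective {I : ℕ} {F : Fin I → ℝ → ℝ} (hF : ∀ i, Monotone (F i)) :
    Function.Injective (freePos F) := by
  intro y y' h
  funext i
  refine sub_eq_zero.1 (eq_zero_of_interaction (d := fun i => y i - y' i)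
    (f := fun i => F i (y i) - F i (y' i)) (fun i => ?_)
    (fun i hi => sub_nonneg.2 (hF i (sub_nonneg.1 hi)))
    (fun i hi => sub_nonpos.2 (hF i (sub_nonpos.1 hi))) i)
  have := congrFun h i
  simp only [freePos] at this
  simp only [mul_sub, Finset.sum_sub_distrib]
  linarith

lemma contDiff_freePos {I : ℕ} {F : Fin I → ℝ → ℝ} (hF : ∀ i, ContDiff ℝ 1 (F i)) :
    ContDiff ℝ 1 (freePos F) :=
  contDiff_pi.2 fun i => (contDiff_apply ℝ ℝ i).add
    (ContDiff.sum fun j _ => contDiff_const.mul ((hF j).comp (contDiff_apply ℝ ℝ j)))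

lemma eq_zero_of_fderiv_freePos {I : ℕ} {F : Fin I → ℝ → ℝ} (hm : ∀ i, Monotone (F i))
    (hF : ∀ i, ContDiff ℝ 1 (F i)) (y v : Fin I → ℝ) (hv : fderiv ℝ (freePos F) y v = 0) :
    v = 0 := by
  have hline : HasDerivAt (fun s : ℝ => y + s • v) v 0 := by
    simpa using ((hasDerivAt_id (0 : ℝ)).smul_const v).const_add y
  have h1 : HasDerivAt (fun s : ℝ => freePos F (y + s • v)) (fderiv ℝ (freePos F) y v) 0 := by
    have hy := ((contDiff_freePos hF).differentiable one_ne_zero y).hasFDerivAt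
    have hy' : HasFDerivAt (freePos F) (fderiv ℝ (freePos F) y) (y + (0 : ℝ) • v) := by
      simpa using hy
    exact hy'.comp_hasDerivAt (0 : ℝ) hline
  rw [hv] at h1
  have hd : ∀ j, HasDerivAt (F j) (deriv (F j) (y j)) (y j) := fun j =>
    ((hF j).differentiable one_ne_zero (y j)).hasDerivAt
  have h2 : ∀ i, v i + ∑ j, 2 * min (sz i) (sz j) * (deriv (F j) (y j) * v j) = 0 := fun i => by
    have h3 := hasDerivAt_pi.1 h1 i
    have hl := hasDerivAt_pi.1 hline
    refine HasDerivAt.unique ((hl i).add (HasDerivAt.fun_sum fun j _ =>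
      (HasDerivAt.comp (0 : ℝ) ?_ (hl j)).const_mul (2 * min (sz i) (sz j)))) h3
    simpa using hd j
  have h4 : ∀ j, 0 ≤ deriv (F j) (y j) := fun j => (hm j).deriv_nonneg
  exact funext (eq_zero_of_interaction h2 (fun i hi => mul_nonneg (h4 i) hi)
    (fun i hi => mul_nonpos_of_nonneg_of_nonpos (h4 i) hi))

/-- The shifted effective distances of the evolved state at the space-time point `(u, t)`. -/
def shiftedDist {I : ℕ} (F : Fin I → ℝ → ℝ) (u t : ℝ) : Fin I → ℝ :=
  Function.invFun (freePos F) fun j => u - sz j * t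

lemma shiftedDist_unique {I : ℕ} {F : Fin I → ℝ → ℝ} (hm : ∀ i, Monotone (F i)) {u t : ℝ}
    {y : Fin I → ℝ} (hy : ∀ i, freePos F y i = u - sz i * t) : shiftedDist F u t = y := by
  rw [shiftedDist, ← funext hy]
  exact Function.leftInverse_invFun (freePos_injective hm) y

/-- `X` solves the implicit system describing the free evolution of the profiles `F`. -/
def IsImplicitSol {I : ℕ} (F : Fin I → ℝ → ℝ) (X : Fin I → ℝ → ℝ → ℝ) : Prop :=
  ∀ i u t, 0 ≤ u → 0 ≤ t → X i u t = F i (phi (fun j v => X j v t) i u - sz i * t)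

section ImplicitSol

variable {I : ℕ} {F : Fin I → ℝ → ℝ} {X : Fin I → ℝ → ℝ → ℝ}

lemma IsImplicitSol.shiftedDist_eq (hX : IsImplicitSol F X) (hm : ∀ i, Monotone (F i)) {u t : ℝ}
    (hu : 0 ≤ u) (ht : 0 ≤ t) :
    shiftedDist F u t = fun i => phi (fun j v => X j v t) i u - sz i * t :=
  shiftedDist_unique hm fun i => by
    simp only [freePos]
    rw [Finset.sum_congr rfl fun j _ => by rw [← hX j u t hu ht]]
    simp only [phi]
    ring

lemma IsImplicitSol.eq_profile (hX : IsImplicitSol F X) (hm : ∀ i, Monotone (F i)) {u t : ℝ}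
    (hu : 0 ≤ u) (ht : 0 ≤ t) (i : Fin I) : X i u t = F i (shiftedDist F u t i) := by
  rw [hX.shiftedDist_eq hm hu ht]
  exact hX i u t hu ht

lemma shiftedDist_of_nonpos (hm : ∀ i, Monotone (F i)) (hF0 : ∀ i z, z ≤ 0 → F i z = 0)
    {u t : ℝ} (hu : u ≤ 0) (ht : 0 ≤ t) : shiftedDist F u t = fun i => u - sz i * t :=
  shiftedDist_unique hm fun i => by
    simp only [freePos]
    rw [Finset.sum_eq_zero fun j _ => ?_, add_zero]
    rw [hF0 j _ (by nlinarith [mul_nonneg (sz_pos j).le ht]), mul_zero]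

lemma profile_shiftedDist_of_nonpos (hm : ∀ i, Monotone (F i))
    (hF0 : ∀ i z, z ≤ 0 → F i z = 0) {u t : ℝ} (hu : u ≤ 0) (ht : 0 ≤ t) (i : Fin I) :
    F i (shiftedDist F u t i) = 0 := by
  rw [shiftedDist_of_nonpos hm hF0 hu ht]
  exact hF0 i _ (by nlinarith [mul_nonneg (sz_pos i).le ht])

lemma IsImplicitSol.freePos_shiftedDist (hX : IsImplicitSol F X) (hm : ∀ i, Monotone (F i))
    (hF0 : ∀ i z, z ≤ 0 → F i z = 0) (u : ℝ) {t : ℝ} (ht : 0 ≤ t) (i : Fin I) :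
    freePos F (shiftedDist F u t) i = u - sz i * t := by
  rcases le_total 0 u with hu | hu
  · simp only [freePos]
    rw [Finset.sum_congr rfl fun j _ => by rw [← hX.eq_profile hm hu ht j],
      hX.shiftedDist_eq hm hu ht]
    simp only [phi]
    ring
  · simp only [freePos]
    rw [Finset.sum_eq_zero fun j _ => by
      rw [profile_shiftedDist_of_nonpos hm hF0 hu ht, mul_zero], add_zero,
      shiftedDist_of_nonpos hm hF0 hu ht]

lemma IsImplicitSol.extZ_eq_profile (hX : IsImplicitSol F X) (hm : ∀ i, Monotone (F i))
    (hF0 : ∀ i z, z ≤ 0 → F i z = 0) (u : ℝ) {t : ℝ} (ht : 0 ≤ t) (i : Fin I) :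
    extZ (fun u => X i u t) u = F i (shiftedDist F u t i) := by
  rcases le_or_gt 0 u with hu | hu
  · simp only [extZ, hu, if_true]
    exact hX.eq_profile hm hu ht i
  · simp only [extZ, not_le.2 hu, if_false]
    exact (profile_shiftedDist_of_nonpos hm hF0 hu.le ht i).symm

lemma IsImplicitSol.contDiffAt_shiftedDist (hX : IsImplicitSol F X) (hm : ∀ i, Monotone (F i))
    (hF0 : ∀ i z, z ≤ 0 → F i z = 0) (hF : ∀ i, ContDiff ℝ 1 (F i)) (u : ℝ) {t : ℝ}
    (ht : 0 ≤ t) : ContDiffAt ℝ 1 (fun p : ℝ × ℝ => shiftedDist F p.1 p.2) (u, t) := by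
  have h1 : ContDiffAt ℝ 1 (Function.invFun (freePos F))
      (freePos F (shiftedDist F u t)) :=
    contDiffAt_of_comp_eventuallyEq (contDiff_freePos hF).contDiffAt
      (eq_zero_of_fderiv_freePos hm hF _) contDiffAt_id
      (Eventually.of_forall (Function.leftInverse_invFun (freePos_injective hm)))
  rw [funext (hX.freePos_shiftedDist hm hF0 u ht)] at h1
  have h2 : ContDiffAt ℝ 1 (fun p : ℝ × ℝ => fun j : Fin I => p.1 - sz j * p.2) (u, t) :=
    (contDiff_pi.2 fun j => contDiff_fst.sub (contDiff_const.mul contDiff_snd)).contDiffAt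
  exact ContDiffAt.comp (u, t) h1 h2

lemma IsImplicitSol.contDiff_extZ (hX : IsImplicitSol F X) (hm : ∀ i, Monotone (F i))
    (hF0 : ∀ i z, z ≤ 0 → F i z = 0) (hF : ∀ i, ContDiff ℝ 1 (F i)) {t : ℝ}
    (ht : 0 ≤ t) (i : Fin I) : ContDiff ℝ 1 (extZ fun u => X i u t) := by
  rw [funext fun u => hX.extZ_eq_profile hm hF0 u ht i, contDiff_iff_contDiffAt]
  intro u
  have h1 : ContDiffAt ℝ 1 (fun w : ℝ => shiftedDist F w t) u :=
    ContDiffAt.comp (g := fun p : ℝ × ℝ => shiftedDist F p.1 p.2) (f := fun w => (w, t)) u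
      (hX.contDiffAt_shiftedDist hm hF0 hF u ht) (contDiff_id.prodMk contDiff_const).contDiffAt
  exact (hF i).contDiffAt.comp u (contDiffAt_pi.1 h1 i)

lemma IsImplicitSol.memCqTwo (hX : IsImplicitSol F X) (hm : ∀ i, Monotone (F i))
    (hF0 : ∀ i z, z ≤ 0 → F i z = 0) (hF : ∀ i, ContDiff ℝ 1 (F i)) (i : Fin I) :
    memCqTwo 1 (X i) := by
  refine ⟨fun u hu t ht => ?_, fun p hp => ?_⟩
  · rw [hX.eq_profile hm hu ht]
    rcases le_total 0 (shiftedDist F u t i) with h | h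
    · rw [← hF0 i 0 le_rfl]; exact hm i h
    · rw [hF0 i _ h]
  · have h1 : ContDiffAt ℝ 1 (fun p : ℝ × ℝ => F i (shiftedDist F p.1 p.2 i)) p :=
      (hF i).contDiffAt.comp p
        (contDiffAt_pi.1 (hX.contDiffAt_shiftedDist hm hF0 hF p.1 hp.2) i)
    rw [Nat.cast_one]
    exact h1.contDiffWithinAt.congr (fun q hq => hX.eq_profile hm hq.1 hq.2 i)
      (hX.eq_profile hm hp.1 hp.2 i)

lemma IsImplicitSol.shiftedDist_lt (hX : IsImplicitSol F X) (hm : ∀ i, Monotone (F i))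
    (hF0 : ∀ i z, z ≤ 0 → F i z = 0) {u v t : ℝ} (ht : 0 ≤ t) (hvu : v < u) (i : Fin I) :
    shiftedDist F v t i < shiftedDist F u t i := by
  refine sub_pos.1 (pos_of_interaction (sub_pos.2 hvu)
    (d := fun i => shiftedDist F u t i - shiftedDist F v t i)
    (f := fun i => F i (shiftedDist F u t i) - F i (shiftedDist F v t i)) (fun i => ?_)
    (fun i hi => sub_nonneg.2 (hm i (sub_nonneg.1 hi)))
    (fun i hi => sub_nonpos.2 (hm i (sub_nonpos.1 hi))) i)
  have h1 := hX.freePos_shiftedDist hm hF0 u ht i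
  have h2 := hX.freePos_shiftedDist hm hF0 v ht i
  simp only [freePos] at h1 h2
  simp only [mul_sub, Finset.sum_sub_distrib]
  linarith

lemma IsImplicitSol.memD (hX : IsImplicitSol F X) (hm : ∀ i, Monotone (F i))
    (hF0 : ∀ i z, z ≤ 0 → F i z = 0) (hF : ∀ i, ContDiff ℝ 1 (F i)) {c : Fin I → ℝ}
    (hc0 : ∀ i, 0 ≤ c i) (hsum : ∑ i, sz i * c i < 1 / 2)
    (hc : ∀ i z w, w ≤ z → F i z - F i w ≤ c i * (z - w)) {t : ℝ} (ht : 0 ≤ t) :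
    memD (fun i u => X i u t) := by
  have hmono : ∀ i, MonotoneOn (fun u => X i u t) (Ici 0) := fun i v hv u hu hvu => by
    simp only
    rw [hX.eq_profile hm hv ht, hX.eq_profile hm hu ht]
    rcases hvu.eq_or_lt with rfl | hlt
    · exact le_rfl
    · exact hm i (hX.shiftedDist_lt hm hF0 ht hlt i).le
  have hC : ∀ i, memC (fun u => X i u t) := fun i =>
    ⟨(hX.contDiff_extZ hm hF0 hF ht i).continuous.continuousOn.congr fun u hu => by
        simp [extZ, mem_Ici.1 hu], hmono i,
      (hX.eq_profile hm le_rfl ht i).trans (profile_shiftedDist_of_nonpos hm hF0 le_rfl ht i),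
      fun u hu => (hX.memCqTwo hm hF0 hF i).1 u hu t ht⟩
  have hcX : ∀ i u v, 0 ≤ v → v < u → X i u t - X i v t ≤
      c i * (phi (fun i u => X i u t) i u - phi (fun i u => X i u t) i v) := by
    intro i u v hv hvu
    have hu := hv.trans hvu.le
    rw [hX.eq_profile hm hu ht, hX.eq_profile hm hv ht]
    refine (hc i _ _ (hX.shiftedDist_lt hm hF0 ht hvu i).le).trans_eq ?_
    rw [hX.shiftedDist_eq hm hu ht, hX.shiftedDist_eq hm hv ht]
    ring
  have hδ : 0 < 1 - 2 * ∑ i, sz i * c i := by linarith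
  have htop : ∀ u v, 0 ≤ v → v < u → (1 - 2 * ∑ i, sz i * c i) * (u - v) ≤
      phiTop (fun i u => X i u t) u - phiTop (fun i u => X i u t) v := by
    intro u v hv hvu
    rw [phiTop_sub_phiTop]
    have : ∑ j, 2 * sz j * (X j u t - X j v t) ≤ ∑ j, 2 * (sz j * c j) * (u - v) :=
      Finset.sum_le_sum fun j _ => by
        have h1 : X j u t - X j v t ≤ c j * (u - v) := (hcX j u v hv hvu).trans
          (mul_le_mul_of_nonneg_left (phi_sub_le hmono j hv hvu.le) (hc0 j))
        have := mul_le_mul_of_nonneg_left h1 (mul_nonneg zero_le_two (sz_pos j).le)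
        linarith
    rw [← Finset.sum_mul, ← Finset.mul_sum] at this
    linarith
  have htop0 : phiTop (fun i u => X i u t) 0 = 0 := by
    simp only [phiTop, (hC _).2.2.1]; simp
  have hstrict : StrictMonoOn (phiTop fun i u => X i u t) (Ici 0) := fun v hv u _ hvu => by
    have := htop u v hv hvu
    nlinarith [mul_pos hδ (sub_pos.2 hvu)]
  refine ⟨⟨hC, ⟨?_, hstrict.monotoneOn, htop0, fun u hu => ?_⟩, hstrict, ?_⟩, c,
    fun i u _ v hv hvu => hcX i u v hv hvu, hsum⟩
  · exact continuousOn_id.sub (continuousOn_finsetSum _ fun j _ => (hC j).1.const_mul _)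
  · rw [← htop0]
    exact hstrict.monotoneOn self_mem_Ici hu hu
  · refine tendsto_atTop_mono' _ ?_ (tendsto_id.const_mul_atTop hδ)
    filter_upwards [eventually_gt_atTop 0] with u hu
    have := htop u 0 le_rfl hu
    rw [htop0, sub_zero, sub_zero] at this
    exact this

lemma IsImplicitSol.pde (hX : IsImplicitSol F X) (hm : ∀ i, Monotone (F i))
    (hF0 : ∀ i z, z ≤ 0 → F i z = 0) (hF : ∀ i, ContDiff ℝ 1 (F i))
    {u t : ℝ} (hu : 0 ≤ u) (ht : 0 ≤ t) (i : Fin I) :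
    derivWithin (fun s => X i u s) (Ici 0) t
      = - veff (fun j => derivWithin (fun w => X j w t) (Ici 0) u) i
          * derivWithin (fun w => X i w t) (Ici 0) u := by
  have hud : ∀ {x : ℝ}, 0 ≤ x → UniqueDiffWithinAt ℝ (Ici (0:ℝ)) x :=
    fun h => uniqueDiffOn_Ici 0 _ h
  have hdiff := ((hX.contDiffAt_shiftedDist hm hF0 hF u ht).differentiableAt
    one_ne_zero).hasFDerivAt
  set L := fderiv ℝ (fun p : ℝ × ℝ => shiftedDist F p.1 p.2) (u, t)
  obtain ⟨q, hq⟩ : ∃ q : Fin I → ℝ, ∀ j, HasDerivAt (fun w => shiftedDist F w t j) (q j) u :=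
    ⟨L (1, 0), hasDerivAt_pi.1 (HasFDerivAt.comp_hasDerivAt (f := fun w => (w, t)) u hdiff
      ((hasDerivAt_id u).prodMk (hasDerivAt_const u t)))⟩
  obtain ⟨r, hr⟩ : ∃ r : Fin I → ℝ, ∀ j, HasDerivAt (fun s => shiftedDist F u s j) (r j) t :=
    ⟨L (0, 1), hasDerivAt_pi.1 (HasFDerivAt.comp_hasDerivAt (f := fun s => (u, s)) t hdiff
      ((hasDerivAt_const t u).prodMk (hasDerivAt_id t)))⟩
  let b : Fin I → ℝ := fun j => deriv (F j) (shiftedDist F u t j)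
  have hb0 : ∀ j, 0 ≤ b j := fun j => (hm j).deriv_nonneg
  have hb : ∀ j, HasDerivAt (F j) (b j) (shiftedDist F u t j) := fun j =>
    ((hF j).differentiable one_ne_zero _).hasDerivAt
  have hFq : ∀ j, HasDerivAt (fun w => F j (shiftedDist F w t j)) (b j * q j) u := fun j =>
    HasDerivAt.comp u (hb j) (hq j)
  have hFr : ∀ j, HasDerivAt (fun s => F j (shiftedDist F u s j)) (b j * r j) t := fun j =>
    HasDerivAt.comp t (hb j) (hr j)
  have hXu : ∀ j, derivWithin (fun w => X j w t) (Ici 0) u = b j * q j := fun j =>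
    ((hFq j).hasDerivWithinAt.congr (fun w hw => hX.eq_profile hm hw ht j)
      (hX.eq_profile hm hu ht j)).derivWithin (hud hu)
  have hXt : ∀ j, derivWithin (fun s => X j u s) (Ici 0) t = b j * r j := fun j =>
    ((hFr j).hasDerivWithinAt.congr (fun s hs => hX.eq_profile hm hu hs j)
      (hX.eq_profile hm hu ht j)).derivWithin (hud ht)
  have hqeq : ∀ k, q k + ∑ j, 2 * min (sz k) (sz j) * (b j * q j) = 1 := fun k => by
    have h1 := (hq k).fun_add (HasDerivAt.fun_sum (u := Finset.univ) fun j _ =>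
      (hFq j).const_mul (2 * min (sz k) (sz j)))
    have h2 : HasDerivAt (fun w => w - sz k * t) 1 u := (hasDerivAt_id u).sub_const _
    refine h1.unique (h2.congr_of_eventuallyEq (Eventually.of_forall fun w => ?_))
    exact hX.freePos_shiftedDist hm hF0 w ht k
  have hreq : ∀ k, r k + ∑ j, 2 * min (sz k) (sz j) * (b j * r j) = - sz k := fun k => by
    have h1 := (hr k).fun_add (HasDerivAt.fun_sum (u := Finset.univ) fun j _ =>
      (hFr j).const_mul (2 * min (sz k) (sz j)))
    have h2 : HasDerivAt (fun s => u - sz k * s) (-(sz k * 1)) t :=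
      ((hasDerivAt_id t).const_mul _).const_sub u
    rw [mul_one] at h2
    refine (hud ht).eq_deriv _ h1.hasDerivWithinAt (h2.hasDerivWithinAt.congr (fun s hs => ?_) ?_)
    · exact hX.freePos_shiftedDist hm hF0 u hs k
    · exact hX.freePos_shiftedDist hm hF0 u ht k
  have hqpos : ∀ k, 0 < q k := pos_of_interaction one_pos hqeq
    (fun j hj => mul_nonneg (hb0 j) hj)
    (fun j hj => mul_nonpos_of_nonneg_of_nonpos (hb0 j) hj)
  have hq1 : ∀ k, 1 - ∑ j, 2 * min (sz k) (sz j) * (b j * q j) = q k := fun k => by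
    linarith [hqeq k]
  have hv : veff (fun j => b j * q j) = fun k => - r k / q k := by
    refine eq_veff (fun j => mul_nonneg (hb0 j) (hqpos j).le)
      (fun k => (hqpos k).trans_eq (hq1 k).symm) fun k => ?_
    rw [hq1, mul_div_cancel₀ _ (hqpos k).ne']
    have : ∀ j, b j * q j * (- r j / q j) = - (b j * r j) := fun j => by
      have := (hqpos j).ne'
      field_simp
    simp only [this, mul_neg, Finset.sum_neg_distrib]
    linarith [hreq k]
  simp only [hXu, hXt, hv]
  have := (hqpos i).ne'
  field_simp

end ImplicitSol

lemma memD.isImplicitSol_Gamma {I : ℕ} {ψ : Fin I → ℝ → ℝ} (h : memD ψ)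
    (hψ : ∀ i, ContDiff ℝ 1 (extZ (ψ i))) :
    IsImplicitSol (profile ψ) fun i u t => Gamma (theta t (Upsilon ψ)) i u := by
  intro i u t hu ht
  have hth : ∀ j z, theta t (Upsilon ψ) j z = profile ψ j (z - sz j * t) := fun _ _ => rfl
  refine (Gamma_eq (fun j => ?_) (fun j z => ?_) (fun j => ?_) hu i).trans (hth i _)
  · exact (h.contDiff_profile hψ j).continuous.comp (continuous_id.sub continuous_const)
  · rw [hth]
    rcases le_total 0 (z - sz j * t) with h1 | h1
    · rw [← h.profile_of_nonpos j le_rfl]; exact h.monotone_profile j h1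
    · rw [h.profile_of_nonpos j h1]
  · rw [hth]
    exact h.profile_of_nonpos j (by nlinarith [mul_nonneg (sz_pos j).le ht])

lemma continuousOn_of_strictMonoOn_implicit {φ : ℝ → ℝ → ℝ} {w g : ℝ → ℝ} {S : Set ℝ}
    (hφ : ∀ a, 0 ≤ a → ContinuousOn (φ a) S) (hmono : ∀ s ∈ S, StrictMonoOn (fun u => φ u s) (Ici 0))
    (hw : ∀ s ∈ S, 0 ≤ w s) (hg : ContinuousOn g S) (hwg : ∀ s ∈ S, φ (w s) s = g s) :
    ContinuousOn w S := by
  intro s hs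
  refine tendsto_order.2 ⟨fun a ha => ?_, fun a ha => ?_⟩
  · rcases lt_or_ge a 0 with h0 | h0
    · filter_upwards [self_mem_nhdsWithin] with x hx using h0.trans_le (hw x hx)
    · have h1 : φ a s < g s := by rw [← hwg s hs]; exact hmono s hs h0 (hw s hs) ha
      filter_upwards [self_mem_nhdsWithin, (hφ a h0 s hs).eventually_lt (hg s hs) h1] with x hx hlt
      rw [← hwg x hx] at hlt
      exact ((hmono x hx).lt_iff_lt h0 (hw x hx)).1 hlt
  · have h0 : 0 ≤ a := (hw s hs).trans ha.le
    have h1 : g s < φ a s := by rw [← hwg s hs]; exact hmono s hs (hw s hs) h0 ha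
    filter_upwards [self_mem_nhdsWithin, (hg s hs).eventually_lt (hφ a h0 s hs) h1] with x hx hlt
    rw [← hwg x hx] at hlt
    exact ((hmono x hx).lt_iff_lt (hw x hx) h0).1 hlt

/-- In effective coordinates a classical solution is constant along free trajectories. -/
lemma hasDerivAt_free_trajectory {I : ℕ} {χ : Fin I → ℝ → ℝ → ℝ}
    (hχ : ∀ i, memCqTwo 1 (χ i)) (hD : ∀ t, 0 ≤ t → memD (fun i u => χ i u t))
    (hpde : ∀ i u t, 0 ≤ u → 0 ≤ t → derivWithin (fun s => χ i u s) (Ici 0) t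
          = - veff (fun j => derivWithin (fun w => χ j w t) (Ici 0) u) i
              * derivWithin (fun w => χ i w t) (Ici 0) u)
    (i : Fin I) {u s z : ℝ} (hu : 0 < u) (hs : 0 < s)
    (hz : z + sz i * s = phi (fun j v => χ j v s) i u) :
    HasDerivAt (fun σ => χ i (rinv (phi (fun j v => χ j v σ) i) (z + sz i * σ)) σ) 0 s := by
  have hQ : Ici (0:ℝ) ×ˢ Ici (0:ℝ) ∈ 𝓝 (u, s) :=
    prod_mem_nhds (Ici_mem_nhds hu) (Ici_mem_nhds hs)
  have hCD : ∀ j, ContDiffAt ℝ 1 (fun p : ℝ × ℝ => χ j p.1 p.2) (u, s) := fun j => by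
    have := (hχ j).2.contDiffAt hQ
    rwa [Nat.cast_one] at this
  let A : Fin I → (ℝ × ℝ →L[ℝ] ℝ) := fun j => fderiv ℝ (fun p : ℝ × ℝ => χ j p.1 p.2) (u, s)
  have hA : ∀ j, HasFDerivAt (fun p : ℝ × ℝ => χ j p.1 p.2) (A j) (u, s) := fun j =>
    ((hCD j).differentiableAt one_ne_zero).hasFDerivAt
  let ρ : Fin I → ℝ := fun j => A j (1, 0)
  have hρ : ∀ j, HasDerivAt (fun w => χ j w s) (ρ j) u := fun j =>
    HasFDerivAt.comp_hasDerivAt (f := fun w => (w, s)) u (hA j)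
      ((hasDerivAt_id u).prodMk (hasDerivAt_const u s))
  have hτ : ∀ j, HasDerivAt (fun t => χ j u t) (A j (0, 1)) s := fun j =>
    HasFDerivAt.comp_hasDerivAt (f := fun t => (u, t)) s (hA j)
      ((hasDerivAt_const s u).prodMk (hasDerivAt_id s))
  obtain ⟨hρ0, hq⟩ := (hD s hs.le).deriv_bounds hu.le fun j => (hρ j).hasDerivWithinAt
  have hlin : ∀ j a b, A j (a, b) = ρ j * a + A j (0, 1) * b := fun j a b => by
    have : ((a, b) : ℝ × ℝ) = a • (1, 0) + b • (0, 1) := by simp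
    rw [this, map_add, map_smul, map_smul, smul_eq_mul, smul_eq_mul]; ring
  have hτv : ∀ j, A j (0, 1) = - veff ρ j * ρ j := fun j => by
    have h1 := hpde j u s hu.le hs.le
    have h2 : ∀ k, derivWithin (fun w => χ k w s) (Ici 0) u = ρ k := fun k =>
      (hρ k).hasDerivWithinAt.derivWithin (uniqueDiffOn_Ici 0 u hu.le)
    rw [(hτ j).hasDerivWithinAt.derivWithin (uniqueDiffOn_Ici 0 s hs.le)] at h1
    simpa only [h2] using h1
  let Ψ : ℝ × ℝ → ℝ × ℝ := fun p => (phi (fun j v => χ j v p.2) i p.1, p.2)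
  let P : ℝ × ℝ → ℝ := fun p => χ i (rinv (phi (fun j v => χ j v p.2) i) p.1) p.2
  have hΨ : ContDiffAt ℝ 1 Ψ (u, s) :=
    (contDiffAt_fst.sub (ContDiffAt.sum fun j _ => contDiffAt_const.mul (hCD j))).prodMk
      contDiffAt_snd
  have hΨ' : HasFDerivAt Ψ (fderiv ℝ Ψ (u, s)) (u, s) :=
    (hΨ.differentiableAt one_ne_zero).hasFDerivAt
  have hΨv : ∀ a b, fderiv ℝ Ψ (u, s) (a, b)
      = (a - ∑ j, 2 * min (sz i) (sz j) * A j (a, b), b) := fun a b => by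
    have h1 : HasFDerivAt Ψ ((ContinuousLinearMap.fst ℝ ℝ ℝ
        - ∑ j, (2 * min (sz i) (sz j)) • A j).prod (ContinuousLinearMap.snd ℝ ℝ ℝ)) (u, s) :=
      (hasFDerivAt_fst.sub (HasFDerivAt.fun_sum fun j _ => (hA j).const_mul _)).prodMk
        hasFDerivAt_snd
    rw [h1.fderiv]
    simp
  have hinj : ∀ v, fderiv ℝ Ψ (u, s) v = 0 → v = 0 := by
    rintro ⟨a, b⟩ h
    rw [hΨv, Prod.mk_eq_zero] at h
    obtain ⟨h1, rfl⟩ := h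
    have h2 : ∀ j, 2 * min (sz i) (sz j) * A j (a, 0) = 2 * min (sz i) (sz j) * ρ j * a :=
      fun j => by rw [hlin]; ring
    rw [Finset.sum_congr rfl fun j _ => h2 j, ← Finset.sum_mul, ← one_sub_mul] at h1
    rw [(mul_eq_zero.1 h1).resolve_left (hq i).ne']
    rfl
  have hPΨ : ∀ᶠ p in 𝓝 (u, s), P (Ψ p) = χ i p.1 p.2 := by
    filter_upwards [hQ] with p hp
    have : rinv (phi (fun j v => χ j v p.2) i) (phi (fun j v => χ j v p.2) i p.1) = p.1 :=
      ((hD p.2 hp.2).strictMonoOn_phi i).injOn.leftInvOn_invFunOn hp.1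
    simp only [P, Ψ, this]
  have hP := ((contDiffAt_of_comp_eventuallyEq hΨ hinj (hCD i) hPΨ).differentiableAt
    one_ne_zero).hasFDerivAt
  have hdir : fderiv ℝ Ψ (u, s) (veff ρ i, 1) = (sz i, 1) := by
    have h1 := veff_eq hρ0 hq i
    rw [hΨv, Prod.mk.injEq]
    refine ⟨Eq.trans ?_ h1, rfl⟩
    rw [one_sub_mul, sub_add, Finset.sum_mul, ← Finset.sum_sub_distrib]
    congr 1
    refine Finset.sum_congr rfl fun j _ => ?_
    rw [hlin, hτv]
    ring
  have hPdir : fderiv ℝ P (Ψ (u, s)) (sz i, 1) = 0 := by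
    have h1 := ((hP.comp (u, s) hΨ').congr_of_eventuallyEq
      (hPΨ.mono fun p hp => hp.symm)).unique (hA i)
    rw [← hdir]
    have h2 := congrArg (fun L : ℝ × ℝ →L[ℝ] ℝ => L (veff ρ i, 1)) h1
    simp only [ContinuousLinearMap.comp_apply] at h2
    rw [h2, hlin, hτv]
    ring
  have hcurve : HasDerivAt (fun σ : ℝ => (z + sz i * σ, σ)) (sz i, 1) s := by
    have := (((hasDerivAt_id s).const_mul (sz i)).const_add z).prodMk (hasDerivAt_id s)
    simpa using this
  have hpt : Ψ (u, s) = (z + sz i * s, s) := by simp only [Ψ, hz]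
  rw [← hPdir]
  rw [hpt] at hP ⊢
  exact HasFDerivAt.comp_hasDerivAt (f := fun σ => (z + sz i * σ, σ)) s hP hcurve

/-- Classical solutions of the effective-speed system satisfy the implicit system. -/
lemma isImplicitSol_of_pde {I : ℕ} {ψ0 : Fin I → ℝ → ℝ} (h0 : memD ψ0)
    {χ : Fin I → ℝ → ℝ → ℝ}
    (hχ : ∀ i, memCqTwo 1 (χ i)) (hD : ∀ t, 0 ≤ t → memD (fun i u => χ i u t))
    (hpde : ∀ i u t, 0 ≤ u → 0 ≤ t → derivWithin (fun s => χ i u s) (Ici 0) t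
          = - veff (fun j => derivWithin (fun w => χ j w t) (Ici 0) u) i
              * derivWithin (fun w => χ i w t) (Ici 0) u)
    (hinit : ∀ i u, 0 ≤ u → χ i u 0 = ψ0 i u) : IsImplicitSol (profile ψ0) χ := by
  intro i u t hu ht
  set φ : ℝ → ℝ → ℝ := fun u s => phi (fun j v => χ j v s) i u with hφdef
  set z := φ u t - sz i * t with hz
  have hφz : φ u t = z + sz i * t := by rw [hz]; ring
  change χ i u t = profile ψ0 i z
  have hφ0 : ∀ s, 0 ≤ s → φ 0 s = 0 := fun s hs =>
    phi_zero (fun j => ((hD s hs).1.1 j).2.2.1) i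
  have hmono : ∀ s, 0 ≤ s → StrictMonoOn (fun u => φ u s) (Ici 0) := fun s hs =>
    (hD s hs).strictMonoOn_phi i
  have hcont : ∀ j, ContinuousOn (fun p : ℝ × ℝ => χ j p.1 p.2) (Ici 0 ×ˢ Ici 0) := fun j =>
    (hχ j).2.continuousOn
  have hrinv : ∀ s y, 0 ≤ s → 0 ≤ y → 0 ≤ rinv (fun u => φ u s) y ∧
      φ (rinv (fun u => φ u s) y) s = y := fun s y hs hy => by
    obtain ⟨v, hv, hvy⟩ := (hD s hs).exists_phi_eq i hy
    have hmem : y ∈ (fun u => φ u s) '' Ici 0 := ⟨v, hv, hvy⟩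
    exact ⟨Function.invFunOn_mem hmem, Function.invFunOn_eq hmem⟩
  have hzt : 0 ≤ z + sz i * t := by
    rw [← hφz]; exact (hD t ht).phi_nonneg i hu
  have hi := sz_pos i
  obtain ⟨s₀, hs₀, hs₀t, hzs₀, hend⟩ : ∃ s₀, 0 ≤ s₀ ∧ s₀ ≤ t ∧ 0 ≤ z + sz i * s₀ ∧
      (s₀ = 0 ∨ z + sz i * s₀ = 0 ∧ z ≤ 0) := by
    rcases le_total 0 z with h | h
    · exact ⟨0, le_rfl, ht, by simpa using h, Or.inl rfl⟩
    · have h1 : z + sz i * (-z / sz i) = 0 := by field_simp; ring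
      refine ⟨-z / sz i, div_nonneg (neg_nonneg.2 h) hi.le, ?_, h1.ge, Or.inr ⟨h1, h⟩⟩
      rw [div_le_iff₀ hi]
      linarith
  have hpos : ∀ s, s₀ ≤ s → 0 ≤ z + sz i * s := fun s hs => by
    nlinarith [mul_le_mul_of_nonneg_left hs hi.le]
  set w : ℝ → ℝ := fun s => rinv (fun u => φ u s) (z + sz i * s) with hw
  have hw0 : ∀ s, s₀ ≤ s → 0 ≤ w s := fun s hs => (hrinv s _ (hs₀.trans hs) (hpos s hs)).1
  have hφw : ∀ s, s₀ ≤ s → φ (w s) s = z + sz i * s := fun s hs =>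
    (hrinv s _ (hs₀.trans hs) (hpos s hs)).2
  have hwt : w t = u := by
    refine (hmono t ht).injOn (hw0 t hs₀t) hu ?_
    simp only [hφw t hs₀t, hφz]
  have hwcont : ContinuousOn w (Icc s₀ t) := by
    refine continuousOn_of_strictMonoOn_implicit (φ := φ) (g := fun s => z + sz i * s)
      (fun a ha => ?_) (fun s hs => hmono s (hs₀.trans hs.1)) (fun s hs => hw0 s hs.1)
      (by fun_prop) (fun s hs => hφw s hs.1)
    refine continuousOn_const.sub (continuousOn_finsetSum _ fun j _ =>
      continuousOn_const.mul ((hcont j).comp (f := fun s => (a, s)) (by fun_prop) fun s hs => ?_))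
    exact ⟨ha, hs₀.trans hs.1⟩
  have hgcont : ContinuousOn (fun s => χ i (w s) s) (Icc s₀ t) :=
    (hcont i).comp (f := fun s => (w s, s)) (hwcont.prodMk continuousOn_id)
      fun s hs => ⟨hw0 s hs.1, hs₀.trans hs.1⟩
  have hgconst : χ i (w t) t = χ i (w s₀) s₀ := by
    rcases hs₀t.eq_or_lt with h | h
    · rw [h]
    · obtain ⟨s, hs, hslope⟩ := exists_hasDerivAt_eq_slope (fun s => χ i (w s) s) (fun _ => 0) h
        hgcont fun s hs => by
          have hspos : 0 < s := hs₀.trans_lt hs.1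
          have hwpos : 0 < w s := by
            refine (hw0 s hs.1.le).lt_of_ne fun h0 => ?_
            have h1 := hφw s hs.1.le
            rw [← h0, hφ0 s hspos.le] at h1
            nlinarith [mul_lt_mul_of_pos_left hs.1 hi]
          exact hasDerivAt_free_trajectory hχ hD hpde i hwpos hspos (hφw s hs.1.le).symm
      have := (div_eq_zero_iff.1 hslope.symm).resolve_right (sub_pos.2 h).ne'
      exact sub_eq_zero.1 this
  rw [← hwt, hgconst]
  rcases hend with rfl | ⟨h1, h2⟩
  · have h3 := hφw 0 le_rfl
    have h4 : φ (w 0) 0 = phi ψ0 i (w 0) := by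
      simp only [hφdef, phi, hinit _ _ (hw0 0 le_rfl)]
    rw [h4, mul_zero, add_zero] at h3
    rw [hinit i _ (hw0 0 le_rfl), ← h3, h0.profile_phi i (hw0 0 le_rfl)]
  · have h3 : w s₀ = 0 := by
      refine (hmono s₀ hs₀).injOn (hw0 s₀ le_rfl) self_mem_Ici ?_
      simp only [hφw s₀ le_rfl, hφ0 s₀ hs₀, h1]
    rw [h3, h0.profile_of_nonpos i h2]
    exact ((hD s₀ hs₀).1.1 i).2.2.1

/-- for `ψ0 ∈ 𝒟¹` and `ψ(u,t) := (Υ⁻¹ ∘ θ_t ∘ Υ(ψ0))(u)` (with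
`Υ⁻¹ = Γ`), each `ψ_i ∈ C¹(ℝ₊²,ℝ₊)`, `ψ(·,t) ∈ 𝒟¹` for all `t ≥ 0`, `ψ` solves
`∂_t ψ_i = -v_i^eff(∂_u ψ) ∂_u ψ_i` on `ℝ₊²` with `ψ(·,0) = ψ0`, and `ψ` is the unique
such solution in the class of `χ` with components in `C¹(ℝ₊²,ℝ₊)` and `χ(·,t) ∈ 𝒟¹`
for all `t ≥ 0`. -/
theorem stmt_18 {I : ℕ} (hI : 1 ≤ I) (ψ0 : Fin I → ℝ → ℝ)
    (h0 : memD ψ0 ∧ ∀ i, memCq 1 (ψ0 i))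
    (ψ : Fin I → ℝ → ℝ → ℝ)
    (hdef : ∀ i u t, ψ i u t = Gamma (theta t (Upsilon ψ0)) i u) :
    (∀ i, memCqTwo 1 (ψ i)) ∧
    (∀ t ∈ Ici (0:ℝ),
      memD (fun i u => ψ i u t) ∧ ∀ i, memCq 1 (fun u => ψ i u t)) ∧
    (∀ i, ∀ u ∈ Ici (0:ℝ), ∀ t ∈ Ici (0:ℝ),
      derivWithin (fun s => ψ i u s) (Ici 0) t
        = - veff (fun j => derivWithin (fun w => ψ j w t) (Ici 0) u) i
            * derivWithin (fun w => ψ i w t) (Ici 0) u) ∧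
    (∀ i, ∀ u ∈ Ici (0:ℝ), ψ i u 0 = ψ0 i u) ∧
    (∀ χ : Fin I → ℝ → ℝ → ℝ,
      (∀ i, memCqTwo 1 (χ i)) →
      (∀ t ∈ Ici (0:ℝ),
        memD (fun i u => χ i u t) ∧ ∀ i, memCq 1 (fun u => χ i u t)) →
      (∀ i, ∀ u ∈ Ici (0:ℝ), ∀ t ∈ Ici (0:ℝ),
        derivWithin (fun s => χ i u s) (Ici 0) t
          = - veff (fun j => derivWithin (fun w => χ j w t) (Ici 0) u) i
              * derivWithin (fun w => χ i w t) (Ici 0) u) →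
      (∀ i, ∀ u ∈ Ici (0:ℝ), χ i u 0 = ψ0 i u) →
      ∀ i, ∀ u ∈ Ici (0:ℝ), ∀ t ∈ Ici (0:ℝ), χ i u t = ψ i u t) := by
  obtain ⟨hD0, hC0⟩ := h0
  have hm := hD0.monotone_profile
  have hF0 : ∀ i z, z ≤ 0 → profile ψ0 i z = 0 := fun i z hz => hD0.profile_of_nonpos i hz
  have hC1 : ∀ i, ContDiff ℝ 1 (extZ (ψ0 i)) := fun i => by
    simpa only [Nat.cast_one] using (hC0 i).2
  have hF := hD0.contDiff_profile hC1
  obtain ⟨c, hc0, hsum, hc⟩ := hD0.profile_bounds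
  have hX : IsImplicitSol (profile ψ0) ψ := by
    obtain rfl : ψ = fun i u t => Gamma (theta t (Upsilon ψ0)) i u :=
      funext fun i => funext fun u => funext fun t => hdef i u t
    exact hD0.isImplicitSol_Gamma hC1
  refine ⟨hX.memCqTwo hm hF0 hF, fun t ht => ?_, fun i u hu t ht => hX.pde hm hF0 hF hu ht i,
    fun i u hu => ?_, fun χ hχ hχD hpde hinit i u hu t ht => ?_⟩
  · have hDt := hX.memD hm hF0 hF hc0 hsum hc ht
    refine ⟨hDt, fun i => ⟨hDt.1.1 i, ?_⟩⟩
    rw [Nat.cast_one]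
    exact hX.contDiff_extZ hm hF0 hF ht i
  · have h1 : shiftedDist (profile ψ0) u 0 = fun j => phi ψ0 j u := shiftedDist_unique hm fun j => by
      simp only [freePos, hD0.profile_phi _ hu]
      simp only [phi]
      ring
    rw [hX.eq_profile hm hu le_rfl, h1]
    exact hD0.profile_phi i hu
  · have hχX : IsImplicitSol (profile ψ0) χ := isImplicitSol_of_pde hD0 hχ
      (fun t ht => (hχD t ht).1) (fun i u t hu ht => hpde i u hu t ht)
      fun i u hu => hinit i u hu
    rw [hX.eq_profile hm hu ht, hχX.eq_profile hm hu ht]
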